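/- arXiv:2208.01151 — 3 statements merged into one kernel-verified Lean document; each statement's English description precedes it below -/
import Mathlib

section
/- Let ι be a nonempty finite index type, let D be a diagonal real matrix of size ι×ι, and let M be any real matrix of size ι×ι. If both I − D·M and I − D·Mᵀ are invertible, then 1ᵀ (I − D·Mᵀ)⁻¹ D 1 = 1ᵀ (I − D·M)⁻¹ D 1; that is, the sum of the entries of the vector (I − D·Mᵀ)⁻¹ (D 1) equals the sum of the entries of the vector (I − D·M)⁻¹ (D 1), where 1 denotes the all-ones vector. -/
open Matrix

/-- The push-through identity for matrix inverses. -/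
theorem Matrix.inv_one_sub_mul_mul {m n R : Type*} [Fintype m] [DecidableEq m] [Fintype n]
    [DecidableEq n] [CommRing R] (A : Matrix m n R) (B : Matrix n m R)
    (hAB : IsUnit (1 - A * B)) (hBA : IsUnit (1 - B * A)) :
    (1 - A * B)⁻¹ * A = A * (1 - B * A)⁻¹ := by
  rw [Matrix.isUnit_iff_isUnit_det] at hAB hBA
  have h : A * (1 - B * A) = (1 - A * B) * A := by
    rw [Matrix.mul_sub, Matrix.sub_mul, Matrix.mul_one, Matrix.one_mul, Matrix.mul_assoc]
  calc (1 - A * B)⁻¹ * A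
      = (1 - A * B)⁻¹ * (A * (1 - B * A)) * (1 - B * A)⁻¹ := by
        rw [← Matrix.mul_assoc, Matrix.mul_nonsing_inv_cancel_right _ _ hBA]
    _ = A * (1 - B * A)⁻¹ := by
        rw [h, Matrix.nonsing_inv_mul_cancel_left _ _ hAB]

/-- The entries of a matrix and of its transpose have the same sum. -/
theorem Matrix.sum_transpose_mulVec_one {n R : Type*} [Fintype n] [NonAssocSemiring R]
    (A : Matrix n n R) :
    ∑ i, (Aᵀ *ᵥ fun _ => (1 : R)) i = ∑ i, (A *ᵥ fun _ => (1 : R)) i := by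
  simp only [Matrix.mulVec, dotProduct, Matrix.transpose_apply, mul_one]
  exact Finset.sum_comm

/-- Power-conservation step of uplink–downlink duality: for a diagonal matrix
`D = diagonal d` and an arbitrary square matrix `M`, if both `I - D·M` and
`I - D·Mᵀ` are invertible, then the sum of the entries of
`(I - D·Mᵀ)⁻¹ (D 1)` equals the sum of the entries of `(I - D·M)⁻¹ (D 1)`. -/
theorem stmt_0 {ι : Type*} [Fintype ι] [DecidableEq ι] [Nonempty ι]
    (d : ι → ℝ) (M : Matrix ι ι ℝ)
    (h1 : IsUnit (1 - Matrix.diagonal d * M))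
    (h2 : IsUnit (1 - Matrix.diagonal d * Mᵀ)) :
    ∑ i, ((1 - Matrix.diagonal d * Mᵀ)⁻¹ *ᵥ (Matrix.diagonal d *ᵥ fun _ => (1 : ℝ))) i
      = ∑ i, ((1 - Matrix.diagonal d * M)⁻¹ *ᵥ (Matrix.diagonal d *ᵥ fun _ => (1 : ℝ))) i := by
  have ht : (1 - diagonal d * M)ᵀ = 1 - Mᵀ * diagonal d := by
    rw [transpose_sub, transpose_one, transpose_mul, diagonal_transpose]
  have h3 : IsUnit (1 - Mᵀ * diagonal d) := by
    rwa [← ht, isUnit_transpose]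
  have key : (1 - diagonal d * Mᵀ)⁻¹ * diagonal d = ((1 - diagonal d * M)⁻¹ * diagonal d)ᵀ := by
    rw [inv_one_sub_mul_mul _ _ h2 h3, transpose_mul, diagonal_transpose, transpose_nonsing_inv,
      ht]
  rw [mulVec_mulVec, mulVec_mulVec, key, sum_transpose_mulVec_one]
end

section
/- Under the stated setup, suppose the target SQINR set {γ_{k,n}} is feasible, i.e. there exists a vector q with all entries q_{k,n} ≥ 0 such that for every user k and sub-carrier n, q_{k,n}·a_{k,n} ≥ γ_{k,n}·( Σ_{i≠k} q_{i,n}·c_{k,n,i} + σ²/ζ² + (1/ζ² − 1)·(1/N_SC)·Σ_{i=1}^{K} Σ_{j=1}^{N_SC} q_{i,j}·d_{k,n,i,j} ). Then the (K·N_SC)×(K·N_SC) matrix I − G is invertible. -/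
open Matrix Finset

/-- If a nonnegative matrix `G` maps some nonnegative vector `q` strictly below itself,
then `1 - G` is invertible: scaling its columns by `q` makes it strictly diagonally dominant. -/
theorem Matrix.isUnit_one_sub_of_mulVec_lt {ι : Type*} [Fintype ι] [DecidableEq ι]
    {G : Matrix ι ι ℝ} (hG : ∀ i j, 0 ≤ G i j) {q : ι → ℝ} (hq : ∀ i, 0 ≤ q i)
    (hlt : ∀ i, (G *ᵥ q) i < q i) : IsUnit (1 - G) := by
  have hdet : ((1 - G) * diagonal q).det ≠ 0 := by
    refine det_ne_zero_of_sum_row_lt_diag fun k => ?_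
    have hoff : ∑ j ∈ univ.erase k, ‖((1 - G) * diagonal q) k j‖ =
        ∑ j ∈ univ.erase k, G k j * q j := by
      refine sum_congr rfl fun j hj => ?_
      rw [mul_diagonal, sub_apply, one_apply_ne (ne_of_mem_erase hj).symm, zero_sub, neg_mul,
        norm_neg, Real.norm_of_nonneg (mul_nonneg (hG k j) (hq j))]
    have hsum : G k k * q k + ∑ j ∈ univ.erase k, G k j * q j < q k := by
      rw [add_sum_erase _ (fun j => G k j * q j) (mem_univ k)]
      exact hlt k
    rw [hoff, mul_diagonal, sub_apply, one_apply_eq]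
    refine lt_of_lt_of_le ?_ (le_abs_self _)
    linarith
  rw [det_mul] at hdet
  exact (isUnit_iff_isUnit_det _).mpr (left_ne_zero_of_mul hdet).isUnit

/-- Lemma 1 of the paper: if the target SQINR set `{γ_{k,n}}` is feasible, i.e. some
nonnegative power allocation `q` meets or exceeds every target, then `I - G` is
invertible, where `G = D(Ψ + Φ)` is the weighted coupling matrix. -/
theorem stmt_3 (K NSC NBS : ℕ) (hK : 0 < K) (hNSC : 0 < NSC) (hNBS : 0 < NBS)
    (h t : Fin K → Fin NSC → Fin NBS → ℂ)
    (hnorm : ∀ k n, ∑ a, ‖t k n a‖ ^ 2 = 1)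
    (a : Fin K → Fin NSC → ℝ)
    (ha : ∀ k n, a k n = ‖∑ x, t k n x * h k n x‖ ^ 2)
    (hapos : ∀ k n, 0 < a k n)
    (c : Fin K → Fin NSC → Fin K → ℝ)
    (hc : ∀ k n i, c k n i = ‖∑ x, t i n x * h k n x‖ ^ 2)
    (d : Fin K → Fin NSC → Fin K → Fin NSC → ℝ)
    (hd : ∀ k n i j, d k n i j = ∑ x, ‖t i j x‖ ^ 2 * ‖h k n x‖ ^ 2)
    (γ : Fin K → Fin NSC → ℝ) (hγ : ∀ k n, 0 < γ k n)
    (σ : ℝ) (hσ : 0 < σ ^ 2) (ζ : ℝ) (hζ : 0 < ζ) (hζ1 : ζ ≤ 1)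
    (G : Matrix (Fin K × Fin NSC) (Fin K × Fin NSC) ℝ)
    (hG : ∀ k n i j, G (k, n) (i, j) =
      (γ k n / a k n) *
        ((if j = n ∧ i ≠ k then c k n i else 0) +
          (1 / (NSC : ℝ)) * (1 / ζ ^ 2 - 1) * d k n i j))
    (hfeas : ∃ q : Fin K × Fin NSC → ℝ, (∀ k n, 0 ≤ q (k, n)) ∧
      ∀ k n, q (k, n) * a k n ≥
        γ k n * ((∑ i ∈ univ.filter (fun i => i ≠ k), q (i, n) * c k n i)
          + σ ^ 2 / ζ ^ 2
          + (1 / ζ ^ 2 - 1) * (1 / (NSC : ℝ)) * ∑ i, ∑ j, q (i, j) * d k n i j)) :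
    IsUnit (1 - G) := by
  obtain ⟨q, hq, hfeas⟩ := hfeas
  have hζ2 : 0 ≤ 1 / ζ ^ 2 - 1 :=
    sub_nonneg.mpr (one_le_one_div (by positivity) (pow_le_one₀ hζ.le hζ1))
  refine isUnit_one_sub_of_mulVec_lt (q := q) ?_ (fun p => hq p.1 p.2) ?_
  · rintro ⟨k, n⟩ ⟨i, j⟩
    have hdnn : 0 ≤ d k n i j := by rw [hd]; positivity
    have hcnn : 0 ≤ c k n i := by rw [hc]; positivity
    have hγk := hγ k n
    have hak := hapos k n
    rw [hG]
    refine mul_nonneg (by positivity) (add_nonneg ?_ (by positivity))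
    split_ifs <;> simp [hcnn]
  · rintro ⟨k, n⟩
    have hinner : ∑ i, ∑ j, (if j = n ∧ i ≠ k then c k n i else 0) * q (i, j) =
        ∑ i ∈ univ.filter (fun i => i ≠ k), q (i, n) * c k n i := by
      rw [sum_filter]
      refine sum_congr rfl fun i _ => ?_
      by_cases hi : i = k <;> simp [hi, ite_mul, mul_comm]
    have hmul : (G *ᵥ q) (k, n) = γ k n *
        ((∑ i ∈ univ.filter (fun i => i ≠ k), q (i, n) * c k n i) +
          (1 / ζ ^ 2 - 1) * (1 / (NSC : ℝ)) * ∑ i, ∑ j, q (i, j) * d k n i j) / a k n := by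
      rw [← hinner, mulVec, dotProduct, Fintype.sum_prod_type, mul_div_right_comm]
      simp only [mul_sum, ← sum_add_distrib]
      refine sum_congr rfl fun i _ => sum_congr rfl fun j _ => ?_
      rw [hG]
      ring
    rw [hmul, div_lt_iff₀ (hapos k n)]
    refine lt_of_lt_of_le (mul_lt_mul_of_pos_left ?_ (hγ k n)) (hfeas k n)
    have hnoise : 0 < σ ^ 2 / ζ ^ 2 := by positivity
    linarith
end

section
/- Let N be a positive integer and let Λ be an (N+1)×(N+1) real matrix with all entries nonnegative whose last row equals (1/S) times the sum of its first N rows, for some real S > 0. Let p ∈ ℝ^{N+1} have all entries strictly positive, with last entry p_{N+1} = 1 and with Σ_{i=1}^{N} p_i ≤ S. Then the supremum, over all vectors x ∈ ℝ^{N+1} with strictly positive entries, of (xᵀ Λ p)/(xᵀ p) equals max_{1 ≤ n ≤ N} (Λ p)_n / p_n. -/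
open Matrix Finset

/-- Weighted ratios `(∑ x i * q i) / (∑ x i * p i)` with positive weights have as least upper
bound the largest coordinate ratio `q i / p i`. -/
theorem isLUB_weighted_ratio {ι : Type*} [Fintype ι] {p q : ι → ℝ} (hp : ∀ i, 0 < p i) {M : ℝ}
    (hle : ∀ i, q i ≤ M * p i) {n : ι} (hn : q n = M * p n) :
    IsLUB ((fun x : ι → ℝ => (∑ i, x i * q i) / (∑ i, x i * p i)) '' {x | ∀ i, 0 < x i}) M := by
  classical
  have hpos : ∀ x : ι → ℝ, (∀ i, 0 < x i) → 0 < ∑ i, x i * p i := fun x hx =>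
    Finset.sum_pos (fun i _ => mul_pos (hx i) (hp i)) ⟨n, mem_univ n⟩
  refine ⟨?_, fun w hw => ?_⟩
  · rintro _ ⟨x, hx, rfl⟩
    refine (div_le_iff₀ (hpos x hx)).2 ?_
    rw [Finset.mul_sum]
    refine Finset.sum_le_sum fun i _ => ?_
    calc x i * q i ≤ x i * (M * p i) := mul_le_mul_of_nonneg_left (hle i) (hx i).le
      _ = M * (x i * p i) := by ring
  · by_contra! hlt
    set C := ∑ i, (q i - w * p i) with hC
    set a := q n - w * p n with ha
    have ha0 : 0 < a := by
      rw [ha, hn, ← sub_mul]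
      exact mul_pos (sub_pos.2 hlt) (hp n)
    have hd : 0 < |C| + 1 := by positivity
    set ε := a / (|C| + 1) with hε
    have hε0 : 0 < ε := div_pos ha0 hd
    have hεa : ε * (|C| + 1) = a := div_mul_cancel₀ a hd.ne'
    have hx : ∀ i, 0 < (if i = n then (1 : ℝ) else 0) + ε := fun i => by
      split_ifs <;> positivity
    have hratio := (div_le_iff₀ (hpos _ hx)).1 (hw ⟨_, hx, rfl⟩)
    have hsum : ∑ i, ((if i = n then (1 : ℝ) else 0) + ε) * (q i - w * p i) = a + ε * C := by
      simp [add_mul, Finset.sum_add_distrib, ← Finset.mul_sum, ha, hC]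
    have hsplit : ∑ i, ((if i = n then (1 : ℝ) else 0) + ε) * (q i - w * p i)
        = ∑ i, ((if i = n then (1 : ℝ) else 0) + ε) * q i
          - w * ∑ i, ((if i = n then (1 : ℝ) else 0) + ε) * p i := by
      rw [Finset.mul_sum, ← Finset.sum_sub_distrib]
      exact Finset.sum_congr rfl fun i _ => by ring
    have hlow : ε * -|C| ≤ ε * C := mul_le_mul_of_nonneg_left (neg_abs_le C) hε0.le
    linarith

/-- Lemma 5 of the paper, in abstract form: for a nonnegative `(N+1)×(N+1)` matrix `Λ`
whose last row is `(1/S)` times the sum of its first `N` rows, and an entrywise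
positive vector `p` with last entry `1` and `∑_{i<N} p_i ≤ S`, the supremum over
entrywise positive `x` of `(xᵀ Λ p)/(xᵀ p)` equals the maximum of the first `N`
coordinate ratios `(Λ p)_n / p_n`. -/
theorem stmt_6 (N : ℕ) (hN : 0 < N)
    (Λ : Matrix (Fin (N + 1)) (Fin (N + 1)) ℝ)
    (hΛ : ∀ i j, 0 ≤ Λ i j)
    (S : ℝ) (hS : 0 < S)
    (hrow : ∀ j, Λ (Fin.last N) j = (1 / S) * ∑ i : Fin N, Λ i.castSucc j)
    (p : Fin (N + 1) → ℝ) (hp : ∀ i, 0 < p i)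
    (hplast : p (Fin.last N) = 1)
    (hpsum : ∑ i : Fin N, p i.castSucc ≤ S) :
    sSup ((fun x : Fin (N + 1) → ℝ =>
        (∑ i, x i * (Λ *ᵥ p) i) / (∑ i, x i * p i)) '' {x | ∀ i, 0 < x i})
      = (univ : Finset (Fin N)).sup' ⟨⟨0, hN⟩, mem_univ _⟩
          (fun n => (Λ *ᵥ p) n.castSucc / p n.castSucc) := by
  set f : Fin N → ℝ := fun n => (Λ *ᵥ p) n.castSucc / p n.castSucc with hf
  have hne : (univ : Finset (Fin N)).Nonempty := ⟨⟨0, hN⟩, mem_univ _⟩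
  set M := (univ : Finset (Fin N)).sup' hne f with hM
  obtain ⟨n, -, hn⟩ := Finset.exists_mem_eq_sup' hne f
  have hfirst : ∀ i : Fin N, (Λ *ᵥ p) i.castSucc ≤ M * p i.castSucc := fun i =>
    (div_le_iff₀ (hp _)).1 (Finset.le_sup' f (mem_univ i))
  have hM0 : 0 ≤ M := by
    rw [hM, hn]
    refine div_nonneg ?_ (hp _).le
    simp only [Matrix.mulVec, dotProduct]
    exact Finset.sum_nonneg fun j _ => mul_nonneg (hΛ _ j) (hp j).le
  have hlast : (Λ *ᵥ p) (Fin.last N) = (1 / S) * ∑ i : Fin N, (Λ *ᵥ p) i.castSucc := by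
    simp only [Matrix.mulVec, dotProduct]
    rw [Finset.sum_comm, Finset.mul_sum]
    refine Finset.sum_congr rfl fun j _ => ?_
    rw [hrow, ← Finset.sum_mul, mul_assoc]
  have hle : ∀ i, (Λ *ᵥ p) i ≤ M * p i := by
    refine Fin.lastCases ?_ hfirst
    rw [hlast, hplast, mul_one, one_div, inv_mul_le_iff₀ hS]
    calc ∑ i : Fin N, (Λ *ᵥ p) i.castSucc ≤ ∑ i : Fin N, M * p i.castSucc :=
          Finset.sum_le_sum fun i _ => hfirst i
      _ = M * ∑ i : Fin N, p i.castSucc := (Finset.mul_sum ..).symm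
      _ ≤ M * S := mul_le_mul_of_nonneg_left hpsum hM0
      _ = S * M := mul_comm ..
  have hattain : (Λ *ᵥ p) n.castSucc = M * p n.castSucc := by
    rw [hM, hn, hf, div_mul_cancel₀ _ (hp _).ne']
  exact (isLUB_weighted_ratio hp hle hattain).csSup_eq ⟨_, p, hp, rfl⟩
end
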